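/- For every b ≥ 2, there exist infinitely many squares of base-b palindromes (hence infinitely many b-wMRH numbers) that are not b-Niven numbers, and therefore not b-MRH numbers. -/

import Mathlib

/-- Sum of the base-`b` digits of `N`. -/
def sumDigits (b N : ℕ) : ℕ := (Nat.digits b N).sum

/-- The base-`b` reversal of `N`. -/
def revDigits (b N : ℕ) : ℕ := Nat.ofDigits b (Nat.digits b N).reverse

/-- `N` is a `b`-MRH number. -/
def IsMRH (b N : ℕ) : Prop :=
  ∃ M : ℕ, 1 ≤ M ∧ N = (M * sumDigits b N) * revDigits b (M * sumDigits b N)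

/-- `N` is a `b`-Niven number. -/
def IsNiven (b N : ℕ) : Prop := 0 < N ∧ sumDigits b N ∣ N

theorem IsMRH.isNiven {b N : ℕ} (hN : 0 < N) (h : IsMRH b N) : IsNiven b N := by
  obtain ⟨M, -, hM⟩ := h
  exact ⟨hN, Dvd.intro_left _ (by rw [mul_right_comm, ← hM])⟩

theorem sumDigits_add_mul {b : ℕ} (hb : 2 ≤ b) {x : ℕ} (hx : x < b) (y : ℕ) :
    sumDigits b (x + b * y) = x + sumDigits b y := by
  unfold sumDigits
  by_cases h : x ≠ 0 ∨ y ≠ 0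
  · rw [Nat.digits_add b hb x y hx h, List.sum_cons]
  · push Not at h
    simp [h.1, h.2]

theorem sumDigits_pow_mul {b : ℕ} (hb : 2 ≤ b) (n y : ℕ) :
    sumDigits b (b ^ n * y) = sumDigits b y := by
  induction n with
  | zero => simp
  | succ n ih =>
    have h := sumDigits_add_mul hb (x := 0) (by omega) (b ^ n * y)
    rw [pow_succ', mul_assoc, ← ih]
    simpa using h

theorem pow_succ_sub_one_eq {b : ℕ} (hb : 2 ≤ b) (n : ℕ) :
    b ^ (n + 1) - 1 = (b - 1) + b * (b ^ n - 1) := by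
  have h1 : b ≤ b * b ^ n := Nat.le_mul_of_pos_right b (by positivity)
  rw [pow_succ', Nat.mul_sub, mul_one]
  omega

theorem digits_pow_sub_one {b : ℕ} (hb : 2 ≤ b) (n : ℕ) :
    Nat.digits b (b ^ n - 1) = List.replicate n (b - 1) := by
  induction n with
  | zero => simp
  | succ n ih =>
    rw [pow_succ_sub_one_eq hb, Nat.digits_add b hb _ _ (by omega) (by omega), ih,
      List.replicate_succ]

theorem sumDigits_pow_sub_one_sq {b : ℕ} (hb : 2 ≤ b) {n : ℕ} (hn : n ≠ 0) :
    sumDigits b ((b ^ n - 1) ^ 2) = n * (b - 1) := by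
  obtain ⟨k, rfl⟩ := Nat.exists_eq_succ_of_ne_zero hn
  obtain ⟨c, rfl⟩ := Nat.exists_eq_add_of_le' hb
  have hrep : sumDigits (c + 2) ((c + 2) ^ k - 1) = k * (c + 1) := by
    simp [sumDigits, digits_pow_sub_one hb]
  have key : ((c + 2) ^ (k + 1) - 1) ^ 2 =
      1 + (c + 2) * ((c + 2) ^ k * (c + (c + 2) * ((c + 2) ^ k - 1))) := by
    rw [pow_succ_sub_one_eq hb]
    obtain ⟨d, hd⟩ : ∃ d, (c + 2) ^ k = d + 1 :=
      Nat.exists_eq_succ_of_ne_zero (by positivity)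
    rw [hd, show c + 2 - 1 = c + 1 by omega, Nat.add_sub_cancel]
    ring
  rw [Nat.succ_eq_add_one, key, sumDigits_add_mul hb (by omega), sumDigits_pow_mul hb,
    sumDigits_add_mul hb (by omega), hrep, show c + 2 - 1 = c + 1 by omega]
  ring

theorem not_isNiven_pow_sub_one_sq {b n : ℕ} (hb : 2 ≤ b) (hn : n ≠ 0) (hbn : b ∣ n) :
    ¬ IsNiven b ((b ^ n - 1) ^ 2) := by
  rintro ⟨-, h⟩
  rw [sumDigits_pow_sub_one_sq hb hn] at h
  have hdvd : b ∣ (b ^ n - 1) ^ 2 := (hbn.mul_right _).trans h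
  have hcop : Nat.Coprime b (b ^ n - 1) := by
    refine Nat.Coprime.coprime_dvd_left (dvd_pow_self b hn) ?_
    have hpos : 1 ≤ b ^ n := Nat.one_le_pow _ _ (by omega)
    exact (Nat.coprime_self_sub_right hpos).2 (Nat.coprime_one_right _)
  have := Nat.Coprime.eq_one_of_dvd (hcop.pow_right 2) hdvd
  omega

theorem palindrome_sq_not_niven_infinite (b : ℕ) (hb : 2 ≤ b) :
    {N : ℕ | (∃ P : ℕ, b ≤ P ∧ (Nat.digits b P).Palindrome ∧ N = P ^ 2) ∧
      ¬ IsNiven b N ∧ ¬ IsMRH b N}.Infinite := by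
  refine Set.infinite_of_injective_forall_mem
    (f := fun m : ℕ => (b ^ (b * (m + 1)) - 1) ^ 2) ?_ fun m => ?_
  · intro m k h
    have hm : 1 ≤ b ^ (b * (m + 1)) := Nat.one_le_pow _ _ (by omega)
    have hk : 1 ≤ b ^ (b * (k + 1)) := Nat.one_le_pow _ _ (by omega)
    have h1 := Nat.pow_left_injective two_ne_zero h
    have h2 : b ^ (b * (m + 1)) = b ^ (b * (k + 1)) := by
      omega
    have h3 := Nat.eq_of_mul_eq_mul_left (by omega) (Nat.pow_right_injective hb h2)
    omega
  · have hle : b ≤ b ^ (b * (m + 1)) - 1 := by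
      have h1 : b ^ 2 ≤ b ^ (b * (m + 1)) :=
        Nat.pow_le_pow_right (by omega) (by nlinarith)
      have h2 : b + 1 ≤ b ^ 2 := by nlinarith
      omega
    have hniven : ¬ IsNiven b ((b ^ (b * (m + 1)) - 1) ^ 2) :=
      not_isNiven_pow_sub_one_sq hb (Nat.mul_ne_zero (by omega) (by omega)) (dvd_mul_right _ _)
    refine ⟨⟨_, hle, ?_, rfl⟩, hniven, fun h => hniven (h.isNiven (pow_pos (by omega) 2))⟩
    rw [digits_pow_sub_one hb]
    exact List.Palindrome.of_reverse_eq List.reverse_replicate
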